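/- arXiv:2602.10004 — 2 statements merged into one kernel-verified Lean document; each statement's English description precedes it below -/
import Mathlib

section
/- (Deterministic stopping certificate, Theorem 1.) Let A be a finite type with at least two elements, let ℓ ∈ ℕ, let p : ℕ → A → ℝ, let t ≤ ℓ, let â ∈ A, and let γ_t := p t â − max_{a ≠ â} p t a be the margin of p t at â. Let c be a real number with 0 ≤ c < 1. If γ_t > 0 and the tail variation satisfies ∑_{k=t}^{ℓ−1} ∑_{a ∈ A} |p (k+1) a − p k a| ≤ c · γ_t, then â is the unique maximizer of p ℓ, i.e., p ℓ â > p ℓ a for all a ≠ â; hence the answer at step t already equals the final answer and t is a safe stop. -/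
open Finset

/-- The margin of `p` at `ahat`: `p ahat` minus the maximum of `p` over the (nonempty)
set of `a ≠ ahat`. -/
noncomputable def margin {A : Type*} [Fintype A] [DecidableEq A] [Nontrivial A]
    (p : A → ℝ) (ahat : A) : ℝ :=
  p ahat - (univ.erase ahat).sup'
    (by obtain ⟨b, hb⟩ := exists_ne ahat
        exact ⟨b, mem_erase.mpr ⟨hb, mem_univ b⟩⟩) p

theorem margin_le_sub {A : Type*} [Fintype A] [DecidableEq A] [Nontrivial A]
    (p : A → ℝ) {ahat a : A} (h : a ≠ ahat) : margin p ahat ≤ p ahat - p a :=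
  sub_le_sub_left (Finset.le_sup' p (mem_erase.mpr ⟨h, mem_univ a⟩)) _

theorem sum_abs_sub_le_tail_variation {A : Type*} [Fintype A]
    (p : ℕ → A → ℝ) {t ℓ : ℕ} (ht : t ≤ ℓ) :
    ∑ a, |p ℓ a - p t a| ≤ ∑ k ∈ Finset.Ico t ℓ, ∑ a, |p (k + 1) a - p k a| := by
  rw [Finset.sum_comm]
  refine Finset.sum_le_sum fun a _ => ?_
  rw [← Finset.sum_Ico_sub (fun k => p k a) ht]
  exact Finset.abs_sum_le_sum_abs _ _

/-- Deterministic stopping certificate (Theorem 1): if the margin `γ_t` of `p t` at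
`ahat` is positive and the tail variation from `t` to `ℓ` is at most `c * γ_t` with
`0 ≤ c < 1`, then `ahat` is the unique maximizer of `p ℓ`, i.e. `t` is a safe stop. -/
theorem stmt_3 {A : Type*} [Fintype A] [DecidableEq A] [Nontrivial A]
    (ℓ : ℕ) (p : ℕ → A → ℝ) (t : ℕ) (ht : t ≤ ℓ) (ahat : A)
    (c : ℝ) (hc0 : 0 ≤ c) (hc1 : c < 1)
    (hγ : 0 < margin (p t) ahat)
    (hTV : ∑ k ∈ Finset.Ico t ℓ, ∑ a, |p (k + 1) a - p k a| ≤ c * margin (p t) ahat) :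
    ∀ a, a ≠ ahat → p ℓ ahat > p ℓ a := by
  intro a ha
  have hpair : |p ℓ a - p t a| + |p ℓ ahat - p t ahat| ≤ ∑ b, |p ℓ b - p t b| := by
    rw [← Finset.sum_pair (f := fun b => |p ℓ b - p t b|) ha]
    exact Finset.sum_le_univ_sum_of_nonneg fun b => abs_nonneg _
  have hlt : c * margin (p t) ahat < margin (p t) ahat := mul_lt_of_lt_one_left hγ hc1
  linarith [margin_le_sub (p t) ha, sum_abs_sub_le_tail_variation p ht,
    le_abs_self (p ℓ a - p t a), neg_abs_le (p ℓ ahat - p t ahat)]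
end

section
/- Let A be a finite type with at least two elements, ℓ ∈ ℕ, p : ℕ → A → ℝ, and suppose each p s (for s ≤ ℓ) has a unique maximizer. Define the safe set S := { s ≤ ℓ : the unique maximizer of p s equals the unique maximizer of p ℓ }. Then S is nonempty (since ℓ ∈ S), so the earliest safe stop τ* := min S exists with τ* ≤ ℓ. Moreover, if t ≤ ℓ satisfies the certificate ∑_{k=t}^{ℓ−1} ∑_{a ∈ A} |p (k+1) a − p k a| ≤ c · γ_t for some 0 ≤ c < 1, where γ_t > 0 is the margin of p t at its unique maximizer, then t ∈ S and hence τ* ≤ t. -/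
open Finset

/-- `ahat` is the unique maximizer of `p`. -/
def IsUniqueMax {A : Type*} (p : A → ℝ) (ahat : A) : Prop :=
  ∀ a, a ≠ ahat → p ahat > p a

theorem le_sub_margin {A : Type*} [Fintype A] [DecidableEq A] [Nontrivial A]
    (p : A → ℝ) {a ahat : A} (h : a ≠ ahat) : p a ≤ p ahat - margin p ahat := by
  have := le_sup' p (mem_erase.mpr ⟨h, mem_univ a⟩)
  unfold margin
  linarith

theorem abs_sub_le_sum_Ico_abs (f : ℕ → ℝ) {m n : ℕ} (h : m ≤ n) :
    |f n - f m| ≤ ∑ k ∈ Ico m n, |f (k + 1) - f k| := by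
  rw [← sum_Ico_sub f h]
  exact abs_sum_le_sum_abs _ _

theorem abs_sub_add_abs_sub_le_tail_variation {A : Type*} [Fintype A] [DecidableEq A]
    (p : ℕ → A → ℝ) {m n : ℕ} (h : m ≤ n) {a b : A} (hab : a ≠ b) :
    |p n a - p m a| + |p n b - p m b| ≤ ∑ k ∈ Ico m n, ∑ x, |p (k + 1) x - p k x| := by
  calc |p n a - p m a| + |p n b - p m b|
      ≤ ∑ k ∈ Ico m n, (|p (k + 1) a - p k a| + |p (k + 1) b - p k b|) := by
        rw [sum_add_distrib]
        exact add_le_add (abs_sub_le_sum_Ico_abs (p · a) h) (abs_sub_le_sum_Ico_abs (p · b) h)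
    _ ≤ ∑ k ∈ Ico m n, ∑ x, |p (k + 1) x - p k x| := by
        refine sum_le_sum fun k _ => ?_
        rw [← sum_pair (f := fun x => |p (k + 1) x - p k x|) hab]
        exact sum_le_sum_of_subset_of_nonneg (subset_univ _) fun _ _ _ => abs_nonneg _

/-- If the tail variation from `t` to `ℓ` is smaller than the margin at `t`, then the
maximizer at `t` is still the unique maximizer at `ℓ`. -/
theorem isUniqueMax_of_tail_variation_lt_margin {A : Type*} [Fintype A] [DecidableEq A]
    [Nontrivial A] (p : ℕ → A → ℝ) {t ℓ : ℕ} (h : t ≤ ℓ) {ahat : A}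
    (hTV : ∑ k ∈ Ico t ℓ, ∑ a, |p (k + 1) a - p k a| < margin (p t) ahat) :
    IsUniqueMax (p ℓ) ahat := by
  intro a ha
  have h₁ := le_sub_margin (p t) ha
  have h₂ := abs_sub_add_abs_sub_le_tail_variation p h ha
  have h₃ := le_abs_self (p ℓ a - p t a)
  have h₄ := neg_abs_le (p ℓ ahat - p t ahat)
  linarith

/-- If every `p s` (for `s ≤ ℓ`) has a unique maximizer, the safe set
`S = {s ≤ ℓ : the unique maximizer of p s equals that of p ℓ}` contains `ℓ`, hence is
nonempty, and its minimum `τ* = sInf S` belongs to `S` and satisfies `τ* ≤ ℓ`.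
Moreover any `t ≤ ℓ` satisfying the tail-variation certificate with constant
`0 ≤ c < 1` and positive margin at its unique maximizer lies in `S`, so `τ* ≤ t`. -/
theorem stmt_4 {A : Type*} [Fintype A] [DecidableEq A] [Nontrivial A]
    (ℓ : ℕ) (p : ℕ → A → ℝ)
    (hmax : ∀ s ≤ ℓ, ∃ ahat, IsUniqueMax (p s) ahat) :
    ∀ S : Set ℕ,
      S = {s | s ≤ ℓ ∧ ∃ ahat, IsUniqueMax (p s) ahat ∧ IsUniqueMax (p ℓ) ahat} →
      (ℓ ∈ S) ∧ (sInf S ∈ S ∧ sInf S ≤ ℓ) ∧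
      (∀ t ≤ ℓ, ∀ c : ℝ, 0 ≤ c → c < 1 →
        ∀ ahat, IsUniqueMax (p t) ahat → 0 < margin (p t) ahat →
          (∑ k ∈ Finset.Ico t ℓ, ∑ a, |p (k + 1) a - p k a| ≤ c * margin (p t) ahat) →
          t ∈ S ∧ sInf S ≤ t) := by
  rintro S rfl
  obtain ⟨b, hb⟩ := hmax ℓ le_rfl
  have hmem : ℓ ∈ {s | s ≤ ℓ ∧ ∃ ahat, IsUniqueMax (p s) ahat ∧ IsUniqueMax (p ℓ) ahat} :=
    ⟨le_rfl, b, hb, hb⟩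
  refine ⟨hmem, ⟨Nat.sInf_mem ⟨ℓ, hmem⟩, Nat.sInf_le hmem⟩, ?_⟩
  intro t ht c _ hc ahat hahat hpos hTV
  have hlt := hTV.trans_lt (mul_lt_of_lt_one_left hpos hc)
  have htS : t ∈ {s | s ≤ ℓ ∧ ∃ ahat, IsUniqueMax (p s) ahat ∧ IsUniqueMax (p ℓ) ahat} :=
    ⟨ht, ahat, hahat, isUniqueMax_of_tail_variation_lt_margin p ht hlt⟩
  exact ⟨htS, Nat.sInf_le htS⟩
end
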